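/- arXiv:1112.2205 — 3 statements merged into one kernel-verified Lean document; each statement's English description precedes it below -/
import Mathlib

section
/- (Claim 1.) Let (Gen1, Enc1, Dec1) be a public-key encryption scheme over types PK1, SK1, M1, C1 whose message type M1 equals the ciphertext type C2 of a second scheme (Gen2, Enc2, Dec2) over PK2, SK2, M2, C2, and suppose the first (outer) scheme is ε-CPA-secure. Fix an inner public key pk2 : PK2 and two interests int0, int1 : M2. In the experiment where (pk1, sk1) ← Gen1, c0 ← Enc2 pk2 int0, c1 ← Enc2 pk2 int1, b is drawn uniformly from Bool, and c* ← Enc1 pk1 (if b then c1 else c0), every adversary D : PK1 × C1 × C2 × C2 → Bool satisfies |Pr[D (pk1, c*, c0, c1) = b] − 1/2| ≤ ε / 2. In particular, given the doubly-encrypted interest together with the two singly-encrypted candidate interests, the adversary has only advantage at most ε/2 over 1/2 in determining which interest the doubly-encrypted ciphertext encapsulates. -/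
/-- CPA distinguishing advantage of a distinguisher `g : PK × C → Bool` against a
public-key encryption scheme with key generation `Gen` and encryption `Enc`,
on the pair of messages `m0, m1`. -/
noncomputable def cpaAdv {PK SK M C : Type*} (Gen : PMF (PK × SK)) (Enc : PK → M → PMF C)
    (g : PK × C → Bool) (m0 m1 : M) : ℝ :=
  |(((Gen.bind fun ks => (Enc ks.1 m1).map fun c => g (ks.1, c))) true).toReal -
   (((Gen.bind fun ks => (Enc ks.1 m0).map fun c => g (ks.1, c))) true).toReal|

/-- A public-key encryption scheme is `ε`-CPA-secure if every distinguisher on every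
pair of messages has CPA distinguishing advantage at most `ε`. -/
def CPASecure {PK SK M C : Type*} (Gen : PMF (PK × SK)) (Enc : PK → M → PMF C)
    (ε : ℝ) : Prop :=
  ∀ (m0 m1 : M) (g : PK × C → Bool), cpaAdv Gen Enc g m0 m1 ≤ ε

namespace PMF

/-- A mixture of distributions that all give `b` a probability within `δ` of `r` does so too. -/
theorem abs_bind_apply_toReal_sub_le {α β : Type*} (p : PMF α) (f : α → PMF β) (b : β) {r δ : ℝ}
    (h : ∀ a, |(f a b).toReal - r| ≤ δ) : |((p.bind f) b).toReal - r| ≤ δ := by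
  have upper : (p.bind f) b ≤ ENNReal.ofReal (r + δ) := by
    calc (p.bind f) b = ∑' a, p a * f a b := p.bind_apply f b
      _ ≤ ∑' a, p a * ENNReal.ofReal (r + δ) := by
        gcongr with a
        refine (ENNReal.le_ofReal_iff_toReal_le ((f a).apply_ne_top b) ?_).2 ?_ <;>
          linarith [(abs_le.1 (h a)).2, ENNReal.toReal_nonneg (a := f a b)]
      _ = ENNReal.ofReal (r + δ) := by rw [ENNReal.tsum_mul_right, p.tsum_coe, one_mul]
  have lower : ENNReal.ofReal (r - δ) ≤ (p.bind f) b := by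
    calc ENNReal.ofReal (r - δ) = ∑' a, p a * ENNReal.ofReal (r - δ) := by
          rw [ENNReal.tsum_mul_right, p.tsum_coe, one_mul]
      _ ≤ ∑' a, p a * f a b := by
        gcongr with a
        refine (ENNReal.ofReal_le_iff_le_toReal ((f a).apply_ne_top b)).2 ?_
        linarith [(abs_le.1 (h a)).1]
      _ = (p.bind f) b := (p.bind_apply f b).symm
  obtain ⟨a, -⟩ := p.support_nonempty
  have hnonneg : 0 ≤ r + δ := by
    linarith [(abs_le.1 (h a)).2, ENNReal.toReal_nonneg (a := f a b)]
  have hne := (p.bind f).apply_ne_top b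
  have hu := (ENNReal.le_ofReal_iff_toReal_le hne hnonneg).1 upper
  have hl := (ENNReal.ofReal_le_iff_le_toReal hne).1 lower
  exact abs_le.2 ⟨by linarith, by linarith⟩

theorem toReal_apply_false (p : PMF Bool) : (p false).toReal = 1 - (p true).toReal := by
  have h := p.tsum_coe
  rw [tsum_fintype, Fintype.sum_bool] at h
  have h' := congrArg ENNReal.toReal h
  rw [ENNReal.toReal_add (p.apply_ne_top _) (p.apply_ne_top _), ENNReal.toReal_one] at h'
  linarith

theorem map_beq_apply_true (p : PMF Bool) (b : Bool) : (p.map (· == b)) true = p b := by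
  rw [map_apply, tsum_fintype, Fintype.sum_bool]
  cases b <;> simp

/-- The success probability of guessing a uniform bit `b` from a sample of `q b`. -/
theorem toReal_uniform_bind_map_beq (q : Bool → PMF Bool) :
    (((uniformOfFintype Bool).bind fun b => (q b).map (· == b)) true).toReal =
      1 / 2 + ((q true true).toReal - (q false true).toReal) / 2 := by
  simp only [bind_apply, map_beq_apply_true, tsum_fintype, Fintype.sum_bool,
    uniformOfFintype_apply, Fintype.card_bool]
  rw [ENNReal.toReal_add (ENNReal.mul_ne_top (by simp) (apply_ne_top _ _))
      (ENNReal.mul_ne_top (by simp) (apply_ne_top _ _)),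
    ENNReal.toReal_mul, ENNReal.toReal_mul, toReal_apply_false]
  norm_num
  ring

end PMF

/-- Guessing which of two fixed messages was encrypted succeeds with probability within `ε / 2`
of `1 / 2` under an `ε`-CPA-secure scheme. -/
theorem CPASecure.abs_guess_sub_half_le {PK SK M C : Type*} {Gen : PMF (PK × SK)}
    {Enc : PK → M → PMF C} {ε : ℝ} (hsec : CPASecure Gen Enc ε) (m0 m1 : M)
    (g : PK × C → Bool) :
    |(((Gen.bind fun ks =>
        (PMF.uniformOfFintype Bool).bind fun b =>
        (Enc ks.1 (if b then m1 else m0)).map fun c => g (ks.1, c) == b) true).toReal) - 1 / 2|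
      ≤ ε / 2 := by
  have hswap : (Gen.bind fun ks =>
        (PMF.uniformOfFintype Bool).bind fun b =>
        (Enc ks.1 (if b then m1 else m0)).map fun c => g (ks.1, c) == b) =
      (PMF.uniformOfFintype Bool).bind fun b =>
        (Gen.bind fun ks => (Enc ks.1 (if b then m1 else m0)).map fun c => g (ks.1, c)).map
          (· == b) := by
    rw [PMF.bind_comm]
    simp only [PMF.map_bind, PMF.map_comp, Function.comp_def]
  have hadv := hsec m0 m1 g
  rw [cpaAdv] at hadv
  rw [hswap, PMF.toReal_uniform_bind_map_beq, add_sub_cancel_left, abs_div, abs_two]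
  simpa using div_le_div_of_nonneg_right hadv zero_le_two

/-- Claim 1: if the outer scheme `(Gen1, Enc1, Dec1)` is `ε`-CPA-secure, then in the
experiment where `(pk1, sk1) ← Gen1`, `c0 ← Enc2 pk2 int0`, `c1 ← Enc2 pk2 int1`,
`b` is uniform, and `c* ← Enc1 pk1 (if b then c1 else c0)`, every adversary
`D : PK1 × C1 × C2 × C2 → Bool` satisfies `|Pr[D (pk1, c*, c0, c1) = b] − 1/2| ≤ ε/2`. -/
theorem claim1_double_encryption_hiding
    {PK1 SK1 C1 PK2 SK2 M2 C2 : Type*}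
    (Gen1 : PMF (PK1 × SK1)) (Enc1 : PK1 → C2 → PMF C1) (Dec1 : SK1 → C1 → Option C2)
    (Gen2 : PMF (PK2 × SK2)) (Enc2 : PK2 → M2 → PMF C2) (Dec2 : SK2 → C2 → Option M2)
    (ε : ℝ) (hsec : CPASecure Gen1 Enc1 ε)
    (pk2 : PK2) (int0 int1 : M2)
    (D : PK1 × C1 × C2 × C2 → Bool) :
    |(((Gen1.bind fun ks =>
        (Enc2 pk2 int0).bind fun c0 =>
        (Enc2 pk2 int1).bind fun c1 =>
        (PMF.uniformOfFintype Bool).bind fun b =>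
        (Enc1 ks.1 (if b then c1 else c0)).map fun cstar =>
          D (ks.1, cstar, c0, c1) == b) true).toReal) - 1 / 2| ≤ ε / 2 := by
  have hswap : (Gen1.bind fun ks =>
        (Enc2 pk2 int0).bind fun c0 =>
        (Enc2 pk2 int1).bind fun c1 =>
        (PMF.uniformOfFintype Bool).bind fun b =>
        (Enc1 ks.1 (if b then c1 else c0)).map fun cstar =>
          D (ks.1, cstar, c0, c1) == b) =
      (Enc2 pk2 int0).bind fun c0 =>
        (Enc2 pk2 int1).bind fun c1 =>
        Gen1.bind fun ks =>
        (PMF.uniformOfFintype Bool).bind fun b =>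
        (Enc1 ks.1 (if b then c1 else c0)).map fun cstar =>
          D (ks.1, cstar, c0, c1) == b := by
    rw [PMF.bind_comm]
    congr 1
    funext c0
    rw [PMF.bind_comm]
  rw [hswap]
  exact PMF.abs_bind_apply_toReal_sub_le _ _ _ fun c0 =>
    PMF.abs_bind_apply_toReal_sub_le _ _ _ fun c1 =>
      hsec.abs_guess_sub_half_le c0 c1 fun x => D (x.1, x.2, c0, c1)
end

section
/- (Cryptographic core of Theorem 1, condition 3, and Theorem 2, condition 2: an honest shared second anonymizing router hides which of two consumers sent which interest.) Let (Gen, Enc, Dec) be an ε-CPA-secure public-key encryption scheme and m, m' : M two messages. In the experiment where (pk, sk) ← Gen, x ← Enc pk m, x' ← Enc pk m', b is drawn uniformly from Bool, and the adversary observes pk together with the ordered pair (x, x') if b = false and (x', x) if b = true, every adversary D : PK × C × C → Bool satisfies |Pr[D = b] − 1/2| ≤ ε. -/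
theorem PMF.toReal_bind_apply {α β : Type*} (p : PMF α) (k : α → PMF β) (b : β) :
    ((p.bind k) b).toReal = ∑' a, (p a).toReal * (k a b).toReal := by
  rw [PMF.bind_apply, ENNReal.tsum_toReal_eq fun a =>
    ENNReal.mul_ne_top (p.apply_ne_top a) ((k a).apply_ne_top b)]
  simp only [ENNReal.toReal_mul]

theorem PMF.toReal_apply_le_one {α : Type*} (p : PMF α) (a : α) : (p a).toReal ≤ 1 :=
  ENNReal.toReal_le_of_le_ofReal zero_le_one (by simpa using p.coe_le_one a)

theorem PMF.summable_toReal_mul {α β : Type*} (p : PMF α) (k : α → PMF β) (b : β) :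
    Summable fun a => (p a).toReal * (k a b).toReal :=
  (ENNReal.summable_toReal p.tsum_coe_ne_top).of_nonneg_of_le
    (fun _ => by positivity)
    fun _ => mul_le_of_le_one_right ENNReal.toReal_nonneg (PMF.toReal_apply_le_one _ _)

/-- The advantage of a randomized test is attained by the deterministic likelihood-ratio test. -/
theorem PMF.exists_toReal_bind_sub_le {α : Type*} (p q : PMF α) (k : α → PMF Bool) :
    ∃ g : α → Bool, (p.bind k true).toReal - (q.bind k true).toReal ≤
      (p.map g true).toReal - (q.map g true).toReal := by
  classical
  refine ⟨fun a => decide (q a ≤ p a), ?_⟩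
  simp only [← PMF.bind_pure_comp, PMF.toReal_bind_apply]
  rw [← (p.summable_toReal_mul _ _).tsum_sub (q.summable_toReal_mul _ _),
    ← (p.summable_toReal_mul _ _).tsum_sub (q.summable_toReal_mul _ _)]
  refine ((p.summable_toReal_mul _ _).sub (q.summable_toReal_mul _ _)).tsum_le_tsum
    (fun a => ?_) ((p.summable_toReal_mul _ _).sub (q.summable_toReal_mul _ _))
  have h0 : 0 ≤ (k a true).toReal := ENNReal.toReal_nonneg
  have h1 := (k a).toReal_apply_le_one true
  by_cases h : q a ≤ p a
  · have := ENNReal.toReal_mono (p.apply_ne_top a) h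
    simp only [Function.comp_apply, h, decide_true, PMF.pure_apply, if_true, ENNReal.toReal_one]
    nlinarith
  · have := ENNReal.toReal_mono (q.apply_ne_top a) (not_le.mp h).le
    simp only [Function.comp_apply, h, decide_false, PMF.pure_apply, Bool.true_eq_false, if_false,
      ENNReal.toReal_zero]
    nlinarith

theorem PMF.toReal_bool_false (p : PMF Bool) : (p false).toReal = 1 - (p true).toReal := by
  have h := congrArg ENNReal.toReal p.tsum_coe
  rw [tsum_bool, ENNReal.toReal_add (p.apply_ne_top _) (p.apply_ne_top _),
    ENNReal.toReal_one] at h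
  linarith

/-- Guessing a uniform bit `b` from a sample of `F b`, where `F b` is a distribution on guesses. -/
theorem PMF.toReal_uniform_bool_guess (F : Bool → PMF Bool) :
    (((PMF.uniformOfFintype Bool).bind fun b => (F b).map (· == b)) true).toReal - 1 / 2 =
      ((F true true).toReal - (F false true).toReal) / 2 := by
  have ht : (F true).map (· == true) = F true := by
    simpa [Function.id_def] using PMF.map_id (F true)
  have hf : (F false).map (· == false) true = F false false := by
    simp [PMF.map_apply]
  rw [PMF.toReal_bind_apply, tsum_bool, ht, hf, (F false).toReal_bool_false]
  simp
  ring

/-- CPA security extends to randomized distinguishers. -/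
theorem CPASecure.abs_bind_sub_le {PK SK M C : Type*} {Gen : PMF (PK × SK)}
    {Enc : PK → M → PMF C} {ε : ℝ} (hsec : CPASecure Gen Enc ε) (m0 m1 : M)
    (k : PK → C → PMF Bool) :
    |((Gen.bind fun ks => (Enc ks.1 m1).bind (k ks.1)) true).toReal -
      ((Gen.bind fun ks => (Enc ks.1 m0).bind (k ks.1)) true).toReal| ≤ ε := by
  have one_sided (m0 m1 : M) :
      ((Gen.bind fun ks => (Enc ks.1 m1).bind (k ks.1)) true).toReal -
        ((Gen.bind fun ks => (Enc ks.1 m0).bind (k ks.1)) true).toReal ≤ ε := by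
    obtain ⟨g, hg⟩ := PMF.exists_toReal_bind_sub_le
      (Gen.bind fun ks => (Enc ks.1 m1).map (Prod.mk ks.1))
      (Gen.bind fun ks => (Enc ks.1 m0).map (Prod.mk ks.1)) fun z => k z.1 z.2
    simp only [PMF.bind_bind, PMF.bind_map, PMF.map_bind, PMF.map_comp] at hg
    exact hg.trans ((le_abs_self _).trans (hsec m0 m1 g))
  exact abs_sub_le_iff.2 ⟨one_sided m0 m1, one_sided m1 m0⟩

/-- Swap game: if `(Gen, Enc, Dec)` is `ε`-CPA-secure then, in the experiment where
`(pk, sk) ← Gen`, `x ← Enc pk m`, `x' ← Enc pk m'`, `b` is uniform, and the adversary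
observes `pk` together with `(x, x')` if `b = false` and `(x', x)` if `b = true`,
every adversary `D : PK × C × C → Bool` satisfies `|Pr[D = b] − 1/2| ≤ ε`. -/
theorem swap_game_hiding
    {PK SK M C : Type*}
    (Gen : PMF (PK × SK)) (Enc : PK → M → PMF C) (Dec : SK → C → Option M)
    (ε : ℝ) (hsec : CPASecure Gen Enc ε)
    (m m' : M) (D : PK × C × C → Bool) :
    |(((Gen.bind fun ks =>
        (Enc ks.1 m).bind fun x =>
        (Enc ks.1 m').bind fun x' =>
        (PMF.uniformOfFintype Bool).map fun b =>
          D (ks.1, if b then (x', x) else (x, x')) == b) true).toReal) - 1 / 2| ≤ ε := by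
  let H (m₁ m₂ : M) : PMF Bool :=
    Gen.bind fun ks => (Enc ks.1 m₁).bind fun x => (Enc ks.1 m₂).map fun x' => D (ks.1, x, x')
  have hswap (m₁ m₂ : M) : H m₁ m₂ = Gen.bind fun ks => (Enc ks.1 m₂).bind fun x' =>
      (Enc ks.1 m₁).map fun x => D (ks.1, x, x') := by
    simp only [H, ← PMF.bind_pure_comp]
    congr 1
    funext ks
    exact PMF.bind_comm _ _ _
  have hgame : (Gen.bind fun ks => (Enc ks.1 m).bind fun x => (Enc ks.1 m').bind fun x' =>
      (PMF.uniformOfFintype Bool).map fun b =>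
        D (ks.1, if b then (x', x) else (x, x')) == b) =
      (PMF.uniformOfFintype Bool).bind fun b =>
        (if b then H m' m else H m m').map (· == b) := by
    simp only [← PMF.bind_pure_comp]
    simp_rw [PMF.bind_comm _ (PMF.uniformOfFintype Bool)]
    congr 1
    funext b
    cases b
    · simp [H, ← PMF.bind_pure_comp, PMF.bind_bind, Function.comp_def]
    · simp [hswap m' m, ← PMF.bind_pure_comp, Function.comp_def]
  have hfst : |(H m' m' true).toReal - (H m m' true).toReal| ≤ ε :=
    hsec.abs_bind_sub_le m m' fun pk x => (Enc pk m').map fun x' => D (pk, x, x')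
  have hsnd : |(H m' m true).toReal - (H m' m' true).toReal| ≤ ε := by
    rw [hswap m' m, hswap m' m']
    exact hsec.abs_bind_sub_le m' m fun pk x => (Enc pk m').map fun x' => D (pk, x', x)
  rw [hgame, PMF.toReal_uniform_bool_guess]
  simp only [if_true, Bool.false_eq_true, if_false]
  rw [abs_le] at *
  constructor <;> linarith
end

section
/- (Core of the unlinkability Corollary: consumer anonymity together with producer anonymity implies consumer–producer unlinkability.) Suppose X0, X1 : PMF α satisfy Adv(g'; X0, X1) ≤ ε_X for every test g' : α → Bool, and Y0, Y1 : PMF β satisfy Adv(h; Y0, Y1) ≤ ε_Y for every test h : β → Bool. Then for every test g : α × β → Bool on the joint view, Adv(g; X0 ⊗ Y0, X1 ⊗ Y1) ≤ ε_X + ε_Y, where X ⊗ Y denotes the independent product of PMFs, i.e., X.bind (fun a => Y.map (fun b => (a, b))). -/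
/-- Probability that a Boolean test `g` outputs `true` on a sample from `X`. -/
noncomputable def prTrue {α : Type*} (X : PMF α) (g : α → Bool) : ℝ :=
  ((X.map g) true).toReal

/-- Distinguishing advantage of a test `g` against the pair of distributions `X0, X1`:
`Adv(g; X0, X1) = |Pr_{c ← X1}[g c = true] − Pr_{c ← X0}[g c = true]|`. -/
noncomputable def adv {α : Type*} (X0 X1 : PMF α) (g : α → Bool) : ℝ :=
  |prTrue X1 g - prTrue X0 g|

/-- Independent product of two PMFs. -/
noncomputable def prodPMF {α β : Type*} (X : PMF α) (Y : PMF β) : PMF (α × β) :=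
  X.bind (fun a => Y.map (fun b => (a, b)))

theorem prTrue_map {α β : Type*} (X : PMF α) (f : α → β) (g : β → Bool) :
    prTrue (X.map f) g = prTrue X (g ∘ f) := by
  simp only [prTrue, PMF.map_comp]

theorem adv_map {α β : Type*} (X0 X1 : PMF α) (f : α → β) (g : β → Bool) :
    adv (X0.map f) (X1.map f) g = adv X0 X1 (g ∘ f) := by
  simp only [adv, prTrue_map]

theorem adv_triangle {α : Type*} (X0 X1 X2 : PMF α) (g : α → Bool) :
    adv X0 X2 g ≤ adv X0 X1 g + adv X1 X2 g := by
  rw [add_comm]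
  exact abs_sub_le _ _ _

theorem hasSum_toReal_pmf {α : Type*} (X : PMF α) : HasSum (fun a => (X a).toReal) 1 := by
  simpa [← ENNReal.tsum_toReal_eq X.apply_ne_top, X.tsum_coe] using
    (ENNReal.summable_toReal X.tsum_coe_ne_top).hasSum

theorem hasSum_prTrue_bind {α β : Type*} (X : PMF α) (f : α → PMF β) (g : β → Bool) :
    HasSum (fun a => (X a).toReal * prTrue (f a) g) (prTrue (X.bind f) g) := by
  have hsum : (X.bind f).map g true = ∑' a, X a * (f a).map g true := by
    rw [PMF.map_bind, PMF.bind_apply]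
  have hne : ∑' a, X a * (f a).map g true ≠ ⊤ := hsum ▸ PMF.apply_ne_top _ _
  simp only [prTrue, hsum, ← ENNReal.toReal_mul]
  rw [ENNReal.tsum_toReal_eq (ENNReal.ne_top_of_tsum_ne_top hne)]
  exact (ENNReal.summable_toReal hne).hasSum

/-- A common random choice of the experiment does not increase the advantage. -/
theorem adv_bind_le {α β : Type*} (X : PMF α) (f0 f1 : α → PMF β) (g : β → Bool) {ε : ℝ}
    (h : ∀ a, adv (f0 a) (f1 a) g ≤ ε) : adv (X.bind f0) (X.bind f1) g ≤ ε := by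
  have hd := (hasSum_prTrue_bind X f1 g).sub (hasSum_prTrue_bind X f0 g)
  have hε : HasSum (fun a => (X a).toReal * ε) ε := by
    simpa using (hasSum_toReal_pmf X).mul_right ε
  refine hd.norm_le_of_bounded hε fun a => ?_
  rw [← mul_sub, Real.norm_eq_abs, abs_mul, abs_of_nonneg ENNReal.toReal_nonneg]
  exact mul_le_mul_of_nonneg_left (h a) ENNReal.toReal_nonneg

theorem prodPMF_eq_bind_right {α β : Type*} (X : PMF α) (Y : PMF β) :
    prodPMF X Y = Y.bind (fun b => X.map (fun a => (a, b))) :=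
  PMF.bind_comm X Y fun a b => PMF.pure (a, b)

/-- Parallel composition (hybrid) lemma: if every test distinguishes `X0` from `X1`
with advantage at most `εX`, and every test distinguishes `Y0` from `Y1` with
advantage at most `εY`, then every test on the joint view distinguishes
`X0 ⊗ Y0` from `X1 ⊗ Y1` with advantage at most `εX + εY`. -/
theorem unlinkability_parallel_composition
    {α β : Type*} (X0 X1 : PMF α) (Y0 Y1 : PMF β) (εX εY : ℝ)
    (hX : ∀ g' : α → Bool, adv X0 X1 g' ≤ εX)
    (hY : ∀ h : β → Bool, adv Y0 Y1 h ≤ εY)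
    (g : α × β → Bool) :
    adv (prodPMF X0 Y0) (prodPMF X1 Y1) g ≤ εX + εY := by
  refine (adv_triangle _ (prodPMF X1 Y0) _ g).trans (add_le_add ?_ ?_)
  · rw [prodPMF_eq_bind_right, prodPMF_eq_bind_right]
    exact adv_bind_le _ _ _ g fun b => (adv_map ..).trans_le (hX _)
  · exact adv_bind_le _ _ _ g fun a => (adv_map ..).trans_le (hY _)
end
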